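/- Let V₀ be a finite-dimensional k-vector space, let V = k̄ ⊗_k V₀, and let σ_V : V → V be the σ-linear map determined by σ_V(a ⊗ v) = σ(a) ⊗ v. Then for every k̄-linear map M : V → V and every w ∈ V there exists v ∈ V such that v − M(σ_V(v)) = w. -/

import Mathlib

open TensorProduct

open Polynomial in
/-- Over an algebraically closed field of characteristic `p`, an iteration of `x ↦ x ^ q + a i * t ^ q`
(with `p ∣ q`) started at `1 + a 0 * t ^ q` reaches the value `t` for a suitable `t`. -/
theorem exists_pow_recurrence {K : Type*} [Field K] [IsAlgClosed K] (p : ℕ) [CharP K p] {q : ℕ}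
    (hq : p ∣ q) (a : ℕ → K) (d : ℕ) :
    ∃ x : ℕ → K, x 0 = 1 + a 0 * x d ^ q ∧ ∀ i, x (i + 1) = x i ^ q + a (i + 1) * x d ^ q := by
  have hq0 : (q : K[X]) = 0 := (CharP.cast_eq_zero_iff K[X] p q).2 hq
  let P : ℕ → K[X] := fun i ↦
    Nat.rec (1 + C (a 0) * X ^ q) (fun i f ↦ f ^ q + C (a (i + 1)) * X ^ q) i
  have hP0 : P 0 = 1 + C (a 0) * X ^ q := rfl
  have hPs (i) : P (i + 1) = P i ^ q + C (a (i + 1)) * X ^ q := rfl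
  have hder : derivative (P d) = 0 := by
    cases d with
    | zero => simp [hP0, derivative_pow, hq0]
    | succ d => simp [hPs, derivative_pow, hq0]
  have hdeg : (P d - X).degree ≠ 0 := by
    intro h
    have h1 : derivative (P d - X) = 0 := by
      rw [eq_C_of_degree_eq_zero h, derivative_C]
    simp [hder] at h1
  obtain ⟨t, ht⟩ := IsAlgClosed.exists_root _ hdeg
  have ht' : (P d).eval t = t := by simpa [sub_eq_zero] using ht
  refine ⟨fun i ↦ (P i).eval t, ?_, fun i ↦ ?_⟩
  · simp only [ht', hP0]
    simp
  · simp only [ht', hPs]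
    simp

/-- In a finite-dimensional space, every sequence has a term in the span of the earlier ones. -/
theorem exists_eq_sum_range_smul {K V : Type*} [Field K] [AddCommGroup V] [Module K V]
    [FiniteDimensional K V] (u : ℕ → V) :
    ∃ (d : ℕ) (a : ℕ → K), u d = ∑ i ∈ Finset.range d, a i • u i := by
  by_contra! h
  have hli (d : ℕ) : LinearIndependent K (fun i : Fin d ↦ u i) := by
    induction d with
    | zero => exact linearIndependent_empty_type
    | succ d ih =>
      rw [linearIndependent_finSucc']
      refine ⟨ih, fun hmem ↦ ?_⟩
      obtain ⟨c, hc⟩ := (Submodule.mem_span_range_iff_exists_fun K).1 hmem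
      refine h d (fun i ↦ if hi : i < d then c ⟨i, hi⟩ else 0) ?_
      rw [Finset.sum_range]
      simpa [Fin.init] using hc.symm
  have := (hli (Module.finrank K V + 1)).fintype_card_le_finrank
  simp at this

/-- If `Φ` is a Frobenius-semilinear endomorphism of a finite-dimensional vector space over an
algebraically closed field, then `1 - Φ` is surjective. -/
theorem exists_sub_semilinear_eq {K V : Type*} [Field K] [IsAlgClosed K] (p : ℕ) [CharP K p] {q : ℕ}
    (hq : p ∣ q) [AddCommGroup V] [Module K V] [FiniteDimensional K V] {σ : K →+* K}
    (hσ : ∀ x, σ x = x ^ q) (Φ : V →ₛₗ[σ] V) (w : V) : ∃ v, v - Φ v = w := by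
  obtain ⟨d, a, hd⟩ := exists_eq_sum_range_smul (K := K) (fun i ↦ Φ^[i] w)
  cases d with
  | zero => exact ⟨0, by simpa using hd.symm⟩
  | succ d =>
    obtain ⟨x, hx0, hxs⟩ := exists_pow_recurrence p hq a d
    refine ⟨∑ i ∈ Finset.range (d + 1), x i • Φ^[i] w, ?_⟩
    have hΦ : Φ (∑ i ∈ Finset.range (d + 1), x i • Φ^[i] w) =
        ∑ i ∈ Finset.range d, x i ^ q • Φ^[i + 1] w +
          ∑ i ∈ Finset.range (d + 1), (a i * x d ^ q) • Φ^[i] w := by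
      simp only [map_sum, map_smulₛₗ, hσ, ← Function.iterate_succ_apply']
      rw [Finset.sum_range_succ]
      rw [Nat.succ_eq_add_one, hd, Finset.smul_sum]
      simp only [smul_smul, mul_comm]
    rw [hΦ, Finset.sum_range_succ', Finset.sum_range_succ' (fun i ↦ (a i * x d ^ q) • Φ^[i] w)]
    conv_lhs => enter [1, 2]; rw [hx0]
    simp only [hxs, add_smul, Finset.sum_add_distrib, one_smul, Function.iterate_zero, id]
    abel

/-- Let `k = 𝔽_q` (with `q = p ^ n`), `K = k̄` an algebraic closure of `k`,
and `σ : K ≃+* K` the Frobenius `x ↦ x ^ q`.  Let `V₀` be a finite-dimensional `k`-vector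
space, `V = K ⊗[k] V₀`, and let `σV : V → V` be the (additive) `σ`-linear map determined by
`σV (a ⊗ v) = σ a ⊗ v`.  Then for every `K`-linear map `M : V → V` and every `w ∈ V` there
exists `v ∈ V` with `v - M (σV v) = w`. -/
theorem sub_linear_frobenius_surjective
    (p n : ℕ) [Fact p.Prime] (hn : n ≠ 0)
    (K : Type*) [Field K] [Algebra (GaloisField p n) K] [IsAlgClosure (GaloisField p n) K]
    (σ : K ≃+* K) (hσ : ∀ x : K, σ x = x ^ p ^ n)
    (V₀ : Type*) [AddCommGroup V₀] [Module (GaloisField p n) V₀]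
    [FiniteDimensional (GaloisField p n) V₀]
    (σV : K ⊗[GaloisField p n] V₀ → K ⊗[GaloisField p n] V₀)
    (hadd : ∀ u v : K ⊗[GaloisField p n] V₀, σV (u + v) = σV u + σV v)
    (hpure : ∀ (a : K) (v : V₀),
      σV (a ⊗ₜ[GaloisField p n] v) = σ a ⊗ₜ[GaloisField p n] v)
    (M : K ⊗[GaloisField p n] V₀ →ₗ[K] K ⊗[GaloisField p n] V₀) :
    ∀ w : K ⊗[GaloisField p n] V₀, ∃ v : K ⊗[GaloisField p n] V₀, v - M (σV v) = w := by
  have : IsAlgClosed K := IsAlgClosure.isAlgClosed (GaloisField p n)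
  have : CharP K p := charP_of_injective_algebraMap (algebraMap (GaloisField p n) K).injective p
  have hzero : σV 0 = 0 := by simpa using hadd 0 0
  have hsmul (c : K) (x : K ⊗[GaloisField p n] V₀) : σV (c • x) = σ c • σV x := by
    induction x with
    | zero => simp [hzero]
    | tmul a v => simp [smul_tmul', hpure]
    | add x y hx hy => rw [smul_add, hadd, hadd, hx, hy, smul_add]
  let Φ : K ⊗[GaloisField p n] V₀ →ₛₗ[(σ : K →+* K)] K ⊗[GaloisField p n] V₀ :=
    { toFun := fun v ↦ M (σV v)
      map_add' := fun u v ↦ by rw [hadd, map_add]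
      map_smul' := fun c v ↦ by rw [hsmul, map_smul, RingEquiv.coe_toRingHom] }
  exact exists_sub_semilinear_eq p (dvd_pow_self p hn) hσ Φ
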